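/- arXiv:2008.01782 — 8 statements merged into one kernel-verified Lean document; each statement's English description precedes it below -/
import Mathlib

section
/- Suppose nodes 1, 2 ∈ V satisfy 𝒩'_1 ⊆ 𝒩'_2. Fix an infection initialization R, and let B be any curing initialization such that Ĩ₁(B, R) is defined (R̄_i + B̄_i > 0 for all i). Define the curing initialization B* by B*_1 = 0, B*_2 = B_1 + B_2, and B*_k = B_k for all k ∉ {1,2}. Then Ĩ₁(B*, R) ≤ Ĩ₁(B, R). In particular, when minimizing Ĩ₁ over curing initializations, a node whose closed neighborhood is nested in another node's closed neighborhood may be assumed to receive no black balls. -/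
open Finset

noncomputable section

namespace Polya

variable {N : ℕ}

/-- Closed neighborhood of node `i`. -/
def nbhd (G : SimpleGraph (Fin N)) [DecidableRel G.Adj] (i : Fin N) : Finset (Fin N) :=
  insert i (G.neighborFinset i)

/-- Super-urn count of a vector `x` at node `i`. -/
def bar (G : SimpleGraph (Fin N)) [DecidableRel G.Adj] (x : Fin N → ℝ) (i : Fin N) : ℝ :=
  ∑ j ∈ nbhd G i, x j

/-- Average infection rate at time 1. -/
def I1 (G : SimpleGraph (Fin N)) [DecidableRel G.Adj] (B R : Fin N → ℝ) : ℝ :=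
  (1 / (N : ℝ)) * ∑ i : Fin N, bar G R i / (bar G R i + bar G B i)

/-- if node `p`'s closed neighborhood is nested in node `q`'s,
moving all black balls of `p` to `q` does not increase `Ĩ₁`. -/
theorem outer_node_no_black_balls (hN : 1 ≤ N)
    (G : SimpleGraph (Fin N)) [DecidableRel G.Adj]
    (p q : Fin N) (hpq : p ≠ q) (hsub : nbhd G p ⊆ nbhd G q)
    (R : Fin N → ℝ) (hR : ∀ j, 0 ≤ R j)
    (B : Fin N → ℝ) (hB : ∀ j, 0 ≤ B j)
    (hpos : ∀ i, 0 < bar G R i + bar G B i) :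
    I1 G (fun k => if k = p then 0 else if k = q then B p + B q else B k) R ≤ I1 G B R := by
  have hmem : ∀ i j, i ∈ nbhd G j → j ∈ nbhd G i := by
    intro i j h
    simp only [nbhd, Finset.mem_insert, SimpleGraph.mem_neighborFinset] at h ⊢
    rcases h with h | h
    · exact Or.inl h.symm
    · exact Or.inr h.symm
  have hle : ∀ i, bar G B i ≤
      bar G (fun k => if k = p then 0 else if k = q then B p + B q else B k) i := by
    intro i
    have e : (fun k => if k = p then 0 else if k = q then B p + B q else B k)
        = fun k => B k + ((if k = q then B p else 0) - (if k = p then B p else 0)) := by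
      funext k
      by_cases h1 : k = p
      · subst h1; simp [hpq]
      · by_cases h2 : k = q
        · subst h2; simp [h1]; ring
        · simp [h1, h2]
    rw [e]
    unfold bar
    rw [Finset.sum_add_distrib, Finset.sum_sub_distrib, Finset.sum_ite_eq', Finset.sum_ite_eq']
    have hp := hB p
    by_cases h : p ∈ nbhd G i
    · have hq : q ∈ nbhd G i := hmem _ _ (hsub (hmem _ _ h))
      simp [h, hq]
    · by_cases hq : q ∈ nbhd G i <;> simp [h, hq, hp]
  unfold I1
  apply mul_le_mul_of_nonneg_left _ (by positivity)
  apply Finset.sum_le_sum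
  intro i _
  apply div_le_div_of_nonneg_left
  · exact Finset.sum_nonneg fun j _ => hR j
  · exact hpos i
  · linarith [hle i]

end Polya
end
end

section
/- Suppose nodes 1, 2 ∈ V satisfy 𝒩'_1 ⊆ 𝒩'_2. Fix a curing initialization B, and let R be any infection initialization such that R̄_i + B̄_i > 0 for all i ∈ V. Define the infection initialization R* by R*_1 = 0, R*_2 = R_1 + R_2, and R*_k = R_k for all k ∉ {1,2}. Then Ĩ₁(B, R*) ≥ Ĩ₁(B, R). In particular, when maximizing Ĩ₁ over infection initializations, a node whose closed neighborhood is nested in another node's closed neighborhood may be assumed to receive no red balls. -/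
open Finset

noncomputable section

namespace Polya

variable {N : ℕ}

/-- if node `p`'s closed neighborhood is nested in node `q`'s,
moving all red balls of `p` to `q` does not decrease `Ĩ₁`. -/
theorem outer_node_no_red_balls (hN : 1 ≤ N)
    (G : SimpleGraph (Fin N)) [DecidableRel G.Adj]
    (p q : Fin N) (hpq : p ≠ q) (hsub : nbhd G p ⊆ nbhd G q)
    (B : Fin N → ℝ) (hB : ∀ j, 0 ≤ B j)
    (R : Fin N → ℝ) (hR : ∀ j, 0 ≤ R j)
    (hpos : ∀ i, 0 < bar G R i + bar G B i) :
    I1 G B R ≤ I1 G B (fun k => if k = p then 0 else if k = q then R p + R q else R k) := by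
  have mem : ∀ i, p ∈ nbhd G i → q ∈ nbhd G i := by
    intro i hi
    have h1 : i ∈ nbhd G p := by
      simp only [nbhd, Finset.mem_insert, SimpleGraph.mem_neighborFinset] at hi ⊢
      exact hi.imp Eq.symm SimpleGraph.Adj.symm
    have h2 := hsub h1
    simp only [nbhd, Finset.mem_insert, SimpleGraph.mem_neighborFinset] at h2 ⊢
    exact h2.imp Eq.symm SimpleGraph.Adj.symm
  have key : ∀ i, bar G R i ≤
      bar G (fun k => if k = p then 0 else if k = q then R p + R q else R k) i := by
    intro i
    have e : (fun k => if k = p then 0 else if k = q then R p + R q else R k)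
        = fun k => R k - (if k = p then R p else 0) + (if k = q then R p else 0) := by
      funext k
      by_cases h1 : k = p
      · subst h1; simp [hpq]
      · by_cases h2 : k = q
        · subst h2; simp [h1, add_comm]
        · simp [h1, h2]
    rw [e]
    unfold bar
    rw [Finset.sum_add_distrib, Finset.sum_sub_distrib, Finset.sum_ite_eq', Finset.sum_ite_eq']
    have := hR p
    have := mem i
    split_ifs <;> first | linarith | tauto
  unfold I1
  refine mul_le_mul_of_nonneg_left (Finset.sum_le_sum fun i _ => ?_) (by positivity)
  have hb : 0 ≤ bar G B i := Finset.sum_nonneg fun j _ => hB j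
  have h1 := hpos i
  have h2 := key i
  rw [div_le_div_iff₀ h1 (by linarith)]
  nlinarith [mul_le_mul_of_nonneg_right h2 hb]

end Polya
end
end

section
/- Let B and B* be two curing initializations (with the same infection initialization R and the same parameters Δ_{r,j}(t), Δ_{b,j}(t)), and let S, S* and Ĩ, Ĩ* denote the corresponding super-urn proportion functions and average infection rates. Fix n ≥ 0, and suppose that S*_{i,t}(a) ≤ S_{i,t}(a) for every i ∈ V, every t ∈ {0, 1, …, n}, and every draw history a ∈ {0,1}^{V×t} (for t = 0 this means S*_{i,0} ≤ S_{i,0}). Then Ĩ*_{t} ≤ Ĩ_{t} for every t ∈ {1, …, n+1}; in particular Ĩ*_{n+1} ≤ Ĩ_{n+1}. -/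
open Finset

noncomputable section

namespace Polya

variable {N : ℕ}

/-- Super-urn proportion of node `i` after `n` draws with history `a`
(`a j t` is the draw of node `j` at time `t+1`). -/
def S (G : SimpleGraph (Fin N)) [DecidableRel G.Adj] (B R : Fin N → ℝ)
    (Δr Δb : Fin N → ℕ → ℝ) (n : ℕ) (a : Fin N → ℕ → Bool) (i : Fin N) : ℝ :=
  (bar G R i + ∑ j ∈ nbhd G i, ∑ t ∈ Finset.range n, if a j t then Δr j t else 0) /
    (bar G R i + bar G B i +
      ∑ j ∈ nbhd G i, ∑ t ∈ Finset.range n, if a j t then Δr j t else Δb j t)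

/-- Extension of a finite draw history to an `ℕ`-indexed one. -/
def ext (n : ℕ) (a : Fin N → Fin n → Bool) : Fin N → ℕ → Bool :=
  fun j t => if h : t < n then a j ⟨t, h⟩ else false

/-- Joint probability of the draw history `a` over the first `n` draws. -/
def Pjoint (G : SimpleGraph (Fin N)) [DecidableRel G.Adj] (B R : Fin N → ℝ)
    (Δr Δb : Fin N → ℕ → ℝ) (n : ℕ) (a : Fin N → ℕ → Bool) : ℝ :=
  ∏ t ∈ Finset.range n, ∏ i : Fin N,
    if a i t then S G B R Δr Δb t a i else 1 - S G B R Δr Δb t a i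

/-- Average infection rate at time `n` (for `n ≥ 1`). -/
def Itilde (G : SimpleGraph (Fin N)) [DecidableRel G.Adj] (B R : Fin N → ℝ)
    (Δr Δb : Fin N → ℕ → ℝ) (n : ℕ) : ℝ :=
  (1 / (N : ℝ)) * ∑ i : Fin N, ∑ a : Fin N → Fin (n - 1) → Bool,
    S G B R Δr Δb (n - 1) (ext (n - 1) a) i * Pjoint G B R Δr Δb (n - 1) (ext (n - 1) a)

def wt (p : ℝ) (b : Bool) : ℝ := if b then p else 1 - p

theorem wt_nonneg {p : ℝ} (h0 : 0 ≤ p) (h1 : p ≤ 1) (b : Bool) : 0 ≤ wt p b := by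
  unfold wt; split_ifs <;> linarith

def Gs {m : ℕ} (f : (Fin m → Bool) → ℝ) (p : Fin m → ℝ) : ℝ :=
  ∑ c : Fin m → Bool, f c * ∏ i, wt (p i) (c i)

theorem Gs_le {m : ℕ} (f g : (Fin m → Bool) → ℝ) (p : Fin m → ℝ)
    (h0 : ∀ i, 0 ≤ p i) (h1 : ∀ i, p i ≤ 1) (h : ∀ c, f c ≤ g c) : Gs f p ≤ Gs g p := by
  unfold Gs
  exact Finset.sum_le_sum fun c _ => mul_le_mul_of_nonneg_right (h c)
    (Finset.prod_nonneg fun i _ => wt_nonneg (h0 i) (h1 i) _)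

theorem Gs_succ {m : ℕ} (f : (Fin (m+1) → Bool) → ℝ) (p : Fin (m+1) → ℝ) :
    Gs f p = p 0 * Gs (fun c => f (Fin.cons true c)) (fun i => p i.succ)
      + (1 - p 0) * Gs (fun c => f (Fin.cons false c)) (fun i => p i.succ) := by
  unfold Gs
  rw [← Equiv.sum_comp (Fin.consEquiv (fun _ : Fin (m+1) => Bool)), Fintype.sum_prod_type]
  simp only [Fin.consEquiv, Equiv.coe_fn_mk, Fin.prod_univ_succ, Fin.cons_zero, Fin.cons_succ,
    Fintype.sum_bool, Finset.mul_sum]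
  congr 1 <;> refine Finset.sum_congr rfl fun c _ => ?_ <;> simp [wt] <;> ring

theorem Gs_mono {m : ℕ} (f : (Fin m → Bool) → ℝ) (hf : Monotone f) (p q : Fin m → ℝ)
    (h0 : ∀ i, 0 ≤ p i) (hpq : ∀ i, p i ≤ q i) (h1 : ∀ i, q i ≤ 1) : Gs f p ≤ Gs f q := by
  induction m with
  | zero => simp [Gs]
  | succ m ih =>
    rw [Gs_succ, Gs_succ]
    have hc : ∀ b, Monotone (fun c : Fin m → Bool => f (Fin.cons b c : Fin (m+1) → Bool)) := by
      intro b c d hcd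
      apply hf
      intro i
      refine Fin.cases ?_ (fun i => ?_) i
      · simp
      · simpa using hcd i
    have a1 := ih _ (hc true) (fun i => p i.succ) (fun i => q i.succ) (fun i => h0 _)
      (fun i => hpq _) (fun i => h1 _)
    have a2 := ih _ (hc false) (fun i => p i.succ) (fun i => q i.succ) (fun i => h0 _)
      (fun i => hpq _) (fun i => h1 _)
    have a3 := Gs_le (fun c : Fin m → Bool => f (Fin.cons false c : Fin (m+1) → Bool))
      (fun c : Fin m → Bool => f (Fin.cons true c : Fin (m+1) → Bool)) (fun i => q i.succ)
      (fun i => (h0 _).trans (hpq _)) (fun i => h1 _) (by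
        intro c
        apply hf
        intro i
        refine Fin.cases ?_ (fun i => ?_) i
        · simp
        · simp)
    have b0 := h0 0
    have b1 := hpq 0
    have b2 := h1 0
    have c1 := mul_le_mul_of_nonneg_left a1 b0
    have c2 := mul_le_mul_of_nonneg_left a2 (by linarith : 0 ≤ 1 - p 0)
    have c3 := mul_le_mul_of_nonneg_left a3 (by linarith : 0 ≤ q 0 - p 0)
    linarith

/-- replace the draws at time `n` -/
def upd (n : ℕ) (a : Fin N → ℕ → Bool) (c : Fin N → Bool) : Fin N → ℕ → Bool :=
  fun j t => if t = n then c j else a j t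

def splitEquiv (N n : ℕ) :
    ((Fin N → Fin n → Bool) × (Fin N → Bool)) ≃ (Fin N → Fin (n+1) → Bool) where
  toFun x := fun j => Fin.snoc (x.1 j) (x.2 j)
  invFun a := (fun j t => a j t.castSucc, fun j => a j (Fin.last n))
  left_inv x := by simp
  right_inv a := by
    funext j t
    refine Fin.lastCases ?_ (fun t => ?_) t <;> simp

theorem ext_split (n : ℕ) (x : (Fin N → Fin n → Bool) × (Fin N → Bool)) :
    ext (n+1) (splitEquiv N n x) = upd n (ext n x.1) x.2 := by
  funext j t
  unfold ext upd splitEquiv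
  simp only [Equiv.coe_fn_mk, Fin.snoc]
  by_cases h : t = n
  · subst h; simp
  · by_cases h2 : t < n
    · have : t < n + 1 := by omega
      simp [h, h2, this]
    · have : ¬ t < n + 1 := by omega
      simp [h, h2, this]

section
variable (G : SimpleGraph (Fin N)) [DecidableRel G.Adj] (B R : Fin N → ℝ)
    (Δr Δb : Fin N → ℕ → ℝ)

theorem S_upd {t n : ℕ} (h : t ≤ n) (a : Fin N → ℕ → Bool) (c : Fin N → Bool) :
    S G B R Δr Δb t (upd n a c) = S G B R Δr Δb t a := by
  funext i
  have key : ∀ j, ∀ s ∈ Finset.range t, upd n a c j s = a j s := by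
    intro j s hs
    have : s ≠ n := by have := Finset.mem_range.1 hs; omega
    simp [upd, this]
  unfold S
  congr 2
  · refine Finset.sum_congr rfl fun j _ => Finset.sum_congr rfl fun s hs => ?_
    rw [key j s hs]
  · refine Finset.sum_congr rfl fun j _ => Finset.sum_congr rfl fun s hs => ?_
    rw [key j s hs]

theorem Pjoint_upd (n : ℕ) (a : Fin N → ℕ → Bool) (c : Fin N → Bool) :
    Pjoint G B R Δr Δb (n+1) (upd n a c) =
      (∏ i, wt (S G B R Δr Δb n a i) (c i)) * Pjoint G B R Δr Δb n a := by
  unfold Pjoint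
  rw [Finset.prod_range_succ, mul_comm]
  congr 1
  · refine Finset.prod_congr rfl fun i _ => ?_
    rw [S_upd G B R Δr Δb le_rfl]
    simp [upd, wt]
  · refine Finset.prod_congr rfl fun t ht => Finset.prod_congr rfl fun i _ => ?_
    have ht := Finset.mem_range.1 ht
    rw [S_upd G B R Δr Δb ht.le]
    simp [upd, ht.ne]

def E (n : ℕ) (f : (Fin N → ℕ → Bool) → ℝ) : ℝ :=
  ∑ a : Fin N → Fin n → Bool, f (ext n a) * Pjoint G B R Δr Δb n (ext n a)

def step (n : ℕ) (f : (Fin N → ℕ → Bool) → ℝ) (a : Fin N → ℕ → Bool) : ℝ :=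
  Gs (fun c => f (upd n a c)) (S G B R Δr Δb n a)

theorem E_succ (n : ℕ) (f : (Fin N → ℕ → Bool) → ℝ) :
    E G B R Δr Δb (n+1) f = E G B R Δr Δb n (step G B R Δr Δb n f) := by
  unfold E step Gs
  rw [← Equiv.sum_comp (splitEquiv N n), Fintype.sum_prod_type]
  refine Finset.sum_congr rfl fun a _ => ?_
  rw [Finset.sum_mul]
  refine Finset.sum_congr rfl fun c _ => ?_
  rw [ext_split, Pjoint_upd]
  ring

variable (hB : ∀ j, 0 ≤ B j) (hR : ∀ j, 0 ≤ R j)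
    (hpos : ∀ i, 0 < bar G R i + bar G B i)
    (hΔr : ∀ j t, 0 ≤ Δr j t) (hΔb : ∀ j t, 0 ≤ Δb j t)

def num (n : ℕ) (a : Fin N → ℕ → Bool) (i : Fin N) : ℝ :=
  bar G R i + ∑ j ∈ nbhd G i, ∑ t ∈ Finset.range n, if a j t then Δr j t else 0

def blu (n : ℕ) (a : Fin N → ℕ → Bool) (i : Fin N) : ℝ :=
  bar G B i + ∑ j ∈ nbhd G i, ∑ t ∈ Finset.range n, if a j t then 0 else Δb j t

theorem S_eq (n : ℕ) (a : Fin N → ℕ → Bool) (i : Fin N) :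
    S G B R Δr Δb n a i = num G R Δr n a i / (num G R Δr n a i + blu G B Δb n a i) := by
  unfold S num blu
  congr 1
  rw [add_add_add_comm, ← Finset.sum_add_distrib]
  congr 1
  refine Finset.sum_congr rfl fun j _ => ?_
  rw [← Finset.sum_add_distrib]
  refine Finset.sum_congr rfl fun t _ => ?_
  split_ifs <;> simp

theorem num_ge (hΔr : ∀ j t, 0 ≤ Δr j t) (n : ℕ) (a : Fin N → ℕ → Bool) (i : Fin N) :
    bar G R i ≤ num G R Δr n a i := by
  unfold num
  refine le_add_of_nonneg_right (Finset.sum_nonneg fun j _ => Finset.sum_nonneg fun t _ => ?_)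
  split_ifs
  · exact hΔr _ _
  · exact le_rfl

theorem blu_ge (hΔb : ∀ j t, 0 ≤ Δb j t) (n : ℕ) (a : Fin N → ℕ → Bool) (i : Fin N) :
    bar G B i ≤ blu G B Δb n a i := by
  unfold blu
  refine le_add_of_nonneg_right (Finset.sum_nonneg fun j _ => Finset.sum_nonneg fun t _ => ?_)
  split_ifs
  · exact le_rfl
  · exact hΔb _ _

theorem num_mono (hΔr : ∀ j t, 0 ≤ Δr j t) (n : ℕ) {a a' : Fin N → ℕ → Bool} (h : a ≤ a')
    (i : Fin N) : num G R Δr n a i ≤ num G R Δr n a' i := by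
  unfold num
  refine add_le_add_right (Finset.sum_le_sum fun j _ => Finset.sum_le_sum fun t _ => ?_) _
  have := h j t
  have := hΔr j t
  cases h1 : a j t <;> cases h2 : a' j t <;> simp_all <;>
    exact absurd ‹true ≤ false› (by decide)

theorem blu_anti (hΔb : ∀ j t, 0 ≤ Δb j t) (n : ℕ) {a a' : Fin N → ℕ → Bool} (h : a ≤ a')
    (i : Fin N) : blu G B Δb n a' i ≤ blu G B Δb n a i := by
  unfold blu
  refine add_le_add_right (Finset.sum_le_sum fun j _ => Finset.sum_le_sum fun t _ => ?_) _
  have := h j t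
  have := hΔb j t
  cases h1 : a j t <;> cases h2 : a' j t <;> simp_all <;>
    exact absurd ‹true ≤ false› (by decide)

theorem bar_nonneg (hR : ∀ j, 0 ≤ R j) (i : Fin N) : 0 ≤ bar G R i :=
  Finset.sum_nonneg fun j _ => hR j

include hB hR hpos hΔr hΔb

theorem S_nonneg (n : ℕ) (a : Fin N → ℕ → Bool) (i : Fin N) : 0 ≤ S G B R Δr Δb n a i := by
  rw [S_eq]
  have h1 := num_ge G R Δr hΔr n a i
  have h2 := blu_ge G B Δb hΔb n a i
  have h3 := bar_nonneg G R hR i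
  have h4 := bar_nonneg G B hB i
  apply div_nonneg <;> linarith

theorem S_le_one (n : ℕ) (a : Fin N → ℕ → Bool) (i : Fin N) : S G B R Δr Δb n a i ≤ 1 := by
  rw [S_eq]
  have h1 := num_ge G R Δr hΔr n a i
  have h2 := blu_ge G B Δb hΔb n a i
  have h3 := bar_nonneg G R hR i
  have h4 := bar_nonneg G B hB i
  apply div_le_one_of_le₀ <;> linarith

theorem S_mono (n : ℕ) (i : Fin N) : Monotone (fun a => S G B R Δr Δb n a i) := by
  intro a a' h
  simp only [S_eq]
  have h1 := num_ge G R Δr hΔr n a i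
  have h2 := blu_ge G B Δb hΔb n a i
  have h1' := num_ge G R Δr hΔr n a' i
  have h2' := blu_ge G B Δb hΔb n a' i
  have h3 := bar_nonneg G R hR i
  have h4 := bar_nonneg G B hB i
  have h5 := hpos i
  rw [div_le_div_iff₀ (by linarith) (by linarith)]
  have := mul_le_mul (num_mono G R Δr hΔr n h i) (blu_anti G B Δb hΔb n h i)
    (by linarith) (by linarith)
  linarith

theorem Pjoint_nonneg (n : ℕ) (a : Fin N → ℕ → Bool) : 0 ≤ Pjoint G B R Δr Δb n a := by
  unfold Pjoint
  exact Finset.prod_nonneg fun t _ => Finset.prod_nonneg fun i _ =>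
    wt_nonneg (S_nonneg G B R Δr Δb hB hR hpos hΔr hΔb t a i)
      (S_le_one G B R Δr Δb hB hR hpos hΔr hΔb t a i) (a i t)

theorem E_le (n : ℕ) (f g : (Fin N → ℕ → Bool) → ℝ) (h : ∀ a, f a ≤ g a) :
    E G B R Δr Δb n f ≤ E G B R Δr Δb n g :=
  Finset.sum_le_sum fun a _ => mul_le_mul_of_nonneg_right (h _)
    (Pjoint_nonneg G B R Δr Δb hB hR hpos hΔr hΔb n _)

theorem step_mono (n : ℕ) (f : (Fin N → ℕ → Bool) → ℝ) (hf : Monotone f) :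
    Monotone (step G B R Δr Δb n f) := by
  intro a a' h
  unfold step
  have h0 := S_nonneg G B R Δr Δb hB hR hpos hΔr hΔb n
  have h1 := S_le_one G B R Δr Δb hB hR hpos hΔr hΔb n
  refine (Gs_le _ (fun c => f (upd n a' c)) _ (h0 a) (h1 a) fun c => hf ?_).trans
    (Gs_mono _ ?_ _ _ (h0 a) (fun i => S_mono G B R Δr Δb hB hR hpos hΔr hΔb n i h) (h1 a'))
  · intro j t
    unfold upd
    split_ifs
    · exact le_rfl
    · exact h j t
  · intro c d hcd
    apply hf
    intro j t
    unfold upd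
    split_ifs
    · exact hcd j
    · exact le_rfl

end

/-- if the super-urn proportions under `B*` are dominated by those
under `B` for all nodes, times `t ≤ n`, and histories, then the average
infection rates satisfy `Ĩ*_t ≤ Ĩ_t` for every `t ∈ {1, …, n+1}`. -/
theorem exposure_domination_implies_infection_domination (hN : 1 ≤ N)
    (G : SimpleGraph (Fin N)) [DecidableRel G.Adj]
    (B Bstar R : Fin N → ℝ)
    (hB : ∀ j, 0 ≤ B j) (hBstar : ∀ j, 0 ≤ Bstar j) (hR : ∀ j, 0 ≤ R j)
    (hpos : ∀ i, 0 < bar G R i + bar G B i)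
    (hposstar : ∀ i, 0 < bar G R i + bar G Bstar i)
    (Δr Δb : Fin N → ℕ → ℝ) (hΔr : ∀ j t, 0 ≤ Δr j t) (hΔb : ∀ j t, 0 ≤ Δb j t)
    (n : ℕ)
    (hS : ∀ i : Fin N, ∀ t, t ≤ n → ∀ a : Fin N → ℕ → Bool,
      S G Bstar R Δr Δb t a i ≤ S G B R Δr Δb t a i) :
    ∀ t, 1 ≤ t → t ≤ n + 1 →
      Itilde G Bstar R Δr Δb t ≤ Itilde G B R Δr Δb t := by
  intro t ht htn
  obtain ⟨m, rfl⟩ : ∃ m, t = m + 1 := ⟨t - 1, by omega⟩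
  have main : ∀ k, k ≤ n → ∀ f : (Fin N → ℕ → Bool) → ℝ, Monotone f →
      E G Bstar R Δr Δb k f ≤ E G B R Δr Δb k f := by
    intro k
    induction k with
    | zero => intro _ f _; simp [E, Pjoint]
    | succ k ih =>
      intro hk f hf
      rw [E_succ, E_succ]
      refine (E_le G Bstar R Δr Δb hBstar hR hposstar hΔr hΔb k _ (step G B R Δr Δb k f)
        fun a => ?_).trans (ih (by omega) _ (step_mono G B R Δr Δb hB hR hpos hΔr hΔb k f hf))
      refine Gs_mono _ ?_ _ _ (S_nonneg G Bstar R Δr Δb hBstar hR hposstar hΔr hΔb k a)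
        (fun i => hS i k (by omega) a) (S_le_one G B R Δr Δb hB hR hpos hΔr hΔb k a)
      intro c d hcd
      apply hf
      intro j t
      unfold upd
      split_ifs
      · exact hcd j
      · exact le_rfl
  unfold Itilde
  simp only [Nat.add_sub_cancel]
  refine mul_le_mul_of_nonneg_left (Finset.sum_le_sum fun i _ => ?_) (by positivity)
  exact (E_le G Bstar R Δr Δb hBstar hR hposstar hΔr hΔb m (fun a => S G Bstar R Δr Δb m a i)
    (fun a => S G B R Δr Δb m a i) fun a => hS i m (by omega) a).trans
    (main m (by omega) _ (S_mono G B R Δr Δb hB hR hpos hΔr hΔb m i))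

end Polya
end
end

section
/- Let σ be an automorphism of G (a permutation of V such that (u,v) is an edge if and only if (σ(u),σ(v)) is an edge), and let m ≥ 1 satisfy σ^m = identity. Let R be an infection initialization with R_i = R_{σ(i)} for all i ∈ V and R̄_i > 0 for all i ∈ V, and let B be a curing initialization. Define the curing initialization B* by B*_i = (1/m) Σ_{j=1}^{m} B_{σ^j(i)} for all i ∈ V. Then Ĩ₁(B*, R) ≤ Ĩ₁(B, R). -/
open Finset

noncomputable section

namespace Polya

variable {N : ℕ}

theorem bar_comp (G : SimpleGraph (Fin N)) [DecidableRel G.Adj]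
    (τ : Equiv.Perm (Fin N)) (hA : ∀ u v : Fin N, G.Adj u v ↔ G.Adj (τ u) (τ v))
    (x : Fin N → ℝ) (i : Fin N) : bar G (fun j => x (τ j)) i = bar G x (τ i) := by
  unfold bar
  refine Finset.sum_equiv τ ?_ ?_
  · intro j
    simp [nbhd, ← hA]
  · intro j _
    rfl

theorem adj_pow (G : SimpleGraph (Fin N))
    (σ : Equiv.Perm (Fin N)) (hA : ∀ u v : Fin N, G.Adj u v ↔ G.Adj (σ u) (σ v)) (l : ℕ) :
    ∀ u v : Fin N, G.Adj u v ↔ G.Adj ((σ ^ l) u) ((σ ^ l) v) := by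
  induction l with
  | zero => intro u v; simp
  | succ k ih =>
    intro u v
    rw [pow_succ, Equiv.Perm.mul_apply, Equiv.Perm.mul_apply, ← ih, ← hA]

theorem inv_pow (σ : Equiv.Perm (Fin N)) (R : Fin N → ℝ) (h : ∀ i, R i = R (σ i)) (l : ℕ) :
    ∀ i, R ((σ ^ l) i) = R i := by
  induction l with
  | zero => intro i; simp
  | succ k ih =>
    intro i
    rw [pow_succ, Equiv.Perm.mul_apply, ih, ← h]

theorem tangent (r a b : ℝ) (hr : 0 < r) (ha : 0 ≤ a) (hb : 0 ≤ b) :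
    r / (r + a) - r / (r + a) ^ 2 * (b - a) ≤ r / (r + b) := by
  have h1 : 0 < r + a := by linarith
  have h2 : 0 < r + b := by linarith
  have : r / (r + b) - (r / (r + a) - r / (r + a) ^ 2 * (b - a))
      = r * (b - a) ^ 2 / ((r + b) * (r + a) ^ 2) := by
    field_simp
    ring
  have h3 : 0 ≤ r * (b - a) ^ 2 / ((r + b) * (r + a) ^ 2) := by positivity
  linarith

theorem jensen (m : ℕ) (hm : 1 ≤ m) (r : ℝ) (hr : 0 < r) (b : ℕ → ℝ) (hb : ∀ l, 0 ≤ b l) :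
    r / (r + (1 / (m : ℝ)) * ∑ l ∈ Finset.range m, b l)
      ≤ (1 / (m : ℝ)) * ∑ l ∈ Finset.range m, r / (r + b l) := by
  have hm0 : (0 : ℝ) < m := by exact_mod_cast hm
  set a := (1 / (m : ℝ)) * ∑ l ∈ Finset.range m, b l with ha
  have ha0 : 0 ≤ a := mul_nonneg (by positivity) (Finset.sum_nonneg fun l _ => hb l)
  have hs : ∑ l ∈ Finset.range m, b l = m * a := by rw [ha]; field_simp
  have h := Finset.sum_le_sum (s := Finset.range m) fun l _ => tangent r a (b l) hr ha0 (hb l)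
  rw [Finset.sum_sub_distrib, ← Finset.mul_sum, Finset.sum_sub_distrib, hs] at h
  simp only [Finset.sum_const, Finset.card_range, nsmul_eq_mul, sub_self, mul_zero, sub_zero] at h
  rw [one_div, inv_mul_eq_div, le_div_iff₀ hm0]
  linarith

/-- for a graph automorphism `σ` with `σ^m = 1` and a
`σ`-invariant infection initialization, symmetrizing the curing initialization
along the orbits of `σ` does not increase `Ĩ₁`. -/
theorem symmetrization_reduces_I1 (hN : 1 ≤ N)
    (G : SimpleGraph (Fin N)) [DecidableRel G.Adj]
    (σ : Equiv.Perm (Fin N)) (hAut : ∀ u v : Fin N, G.Adj u v ↔ G.Adj (σ u) (σ v))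
    (m : ℕ) (hm : 1 ≤ m) (hord : σ ^ m = 1)
    (R : Fin N → ℝ) (hR : ∀ j, 0 ≤ R j)
    (hRinv : ∀ i : Fin N, R i = R (σ i))
    (hRpos : ∀ i : Fin N, 0 < bar G R i)
    (B : Fin N → ℝ) (hB : ∀ j, 0 ≤ B j) :
    I1 G (fun i => (1 / (m : ℝ)) * ∑ l ∈ Finset.range m, B ((σ ^ (l + 1)) i)) R
      ≤ I1 G B R := by
  unfold I1
  refine mul_le_mul_of_nonneg_left ?_ (by positivity)
  have hm0 : (m : ℝ) ≠ 0 := by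
    have : m ≠ 0 := by omega
    exact_mod_cast this
  have hRb : ∀ l i, bar G R ((σ ^ l) i) = bar G R i := by
    intro l i
    rw [← bar_comp G (σ ^ l) (adj_pow G σ hAut l)]
    simp only [inv_pow σ R hRinv l]
  have hBs : ∀ i, bar G (fun i => (1 / (m : ℝ)) * ∑ l ∈ Finset.range m, B ((σ ^ (l + 1)) i)) i
      = (1 / (m : ℝ)) * ∑ l ∈ Finset.range m, bar G B ((σ ^ (l + 1)) i) := by
    intro i
    simp only [← bar_comp G _ (adj_pow G σ hAut _) B]
    unfold bar
    rw [← Finset.mul_sum, Finset.sum_comm]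
  have hB0 : ∀ i, 0 ≤ bar G B i := fun i => Finset.sum_nonneg fun j _ => hB j
  calc _ ≤ ∑ i : Fin N, (1 / (m : ℝ)) * ∑ l ∈ Finset.range m,
          bar G R i / (bar G R i + bar G B ((σ ^ (l + 1)) i)) := by
        refine Finset.sum_le_sum fun i _ => ?_
        rw [hBs]
        exact jensen m hm _ (hRpos i) (fun l => bar G B ((σ ^ (l + 1)) i)) fun l => hB0 _
    _ = (1 / (m : ℝ)) * ∑ l ∈ Finset.range m, ∑ i : Fin N,
          bar G R i / (bar G R i + bar G B i) := by
        rw [← Finset.mul_sum, Finset.sum_comm]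
        congr 1
        refine Finset.sum_congr rfl fun l _ => ?_
        rw [← Equiv.sum_comp (σ ^ (l + 1)) fun i => bar G R i / (bar G R i + bar G B i)]
        simp only [hRb]
    _ = _ := by
        rw [Finset.sum_const, Finset.card_range, nsmul_eq_mul]
        field_simp

end Polya
end
end

section
/- Fix a curing initialization B with B_j ≥ 0 for all j ∈ V. Then the map R ↦ Ĩ₁(B, R) = (1/N) Σ_{i∈V} R̄_i/(R̄_i + B̄_i) is concave on the convex set {R ∈ ℝ^V : R_j ≥ 0 for all j ∈ V and R̄_i + B̄_i > 0 for all i ∈ V}. -/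
open Finset

noncomputable section

namespace Polya

variable {N : ℕ}

theorem scalar_aux (x y c a b : ℝ) (hc : 0 ≤ c) (hx : 0 < x + c) (hy : 0 < y + c)
    (ha : 0 ≤ a) (hb : 0 ≤ b) (hab : a + b = 1) :
    0 < a * x + b * y + c ∧
    a * (x / (x + c)) + b * (y / (y + c)) ≤ (a * x + b * y) / (a * x + b * y + c) := by
  have hw : 0 < a * x + b * y + c := by
    have e : a * x + b * y + c = a * (x + c) + b * (y + c) := by
      linear_combination (-c) * hab
    rw [e]
    rcases ha.eq_or_lt with h | h
    · have : b = 1 := by linarith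
      subst this
      rw [← h]; linarith
    · have := mul_pos h hx
      have := mul_nonneg hb hy.le
      linarith
  refine ⟨hw, ?_⟩
  have key : (a * x + b * y) / (a * x + b * y + c) - (a * (x / (x + c)) + b * (y / (y + c)))
      = c * (a * b * (x - y) ^ 2) / ((x + c) * (y + c) * (a * x + b * y + c)) := by
    have hb' : b = 1 - a := by linarith
    subst hb'
    have := hx.ne'
    have := hy.ne'
    have := hw.ne'
    field_simp
    ring
  have : 0 ≤ c * (a * b * (x - y) ^ 2) / ((x + c) * (y + c) * (a * x + b * y + c)) := by
    positivity
  linarith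

theorem bar_comb (G : SimpleGraph (Fin N)) [DecidableRel G.Adj] (x y : Fin N → ℝ) (a b : ℝ)
    (i : Fin N) : bar G (a • x + b • y) i = a * bar G x i + b * bar G y i := by
  simp [bar, Finset.sum_add_distrib, Finset.mul_sum]

/-- for a fixed nonnegative curing initialization `B`, the map
`R ↦ Ĩ₁(B, R)` is concave on the set of nonnegative infection initializations
for which all super-urn totals are positive. -/
theorem I1_concaveOn (hN : 1 ≤ N)
    (G : SimpleGraph (Fin N)) [DecidableRel G.Adj]
    (B : Fin N → ℝ) (hB : ∀ j, 0 ≤ B j) :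
    ConcaveOn ℝ
      {R : Fin N → ℝ | (∀ j, 0 ≤ R j) ∧ ∀ i : Fin N, 0 < bar G R i + bar G B i}
      (fun R => I1 G B R) := by
  have hc : ∀ i, 0 ≤ bar G B i := fun i => Finset.sum_nonneg fun j _ => hB j
  refine ⟨?_, ?_⟩
  · rintro x ⟨hx, hx'⟩ y ⟨hy, hy'⟩ a b ha hb hab
    refine ⟨fun j => ?_, fun i => ?_⟩
    · have h1 := mul_nonneg ha (hx j)
      have h2 := mul_nonneg hb (hy j)
      simpa using add_nonneg h1 h2
    · rw [bar_comb]
      exact (scalar_aux _ _ _ a b (hc i) (hx' i) (hy' i) ha hb hab).1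
  · rintro x ⟨hx, hx'⟩ y ⟨hy, hy'⟩ a b ha hb hab
    have h : a * ∑ i : Fin N, bar G x i / (bar G x i + bar G B i)
        + b * ∑ i : Fin N, bar G y i / (bar G y i + bar G B i)
        ≤ ∑ i : Fin N, bar G (a • x + b • y) i / (bar G (a • x + b • y) i + bar G B i) := by
      rw [Finset.mul_sum, Finset.mul_sum, ← Finset.sum_add_distrib]
      refine Finset.sum_le_sum fun i _ => ?_
      rw [bar_comb]
      exact (scalar_aux _ _ _ a b (hc i) (hx' i) (hy' i) ha hb hab).2
    have h2 := mul_le_mul_of_nonneg_left h (by positivity : (0 : ℝ) ≤ 1 / (N : ℝ))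
    simp only [I1, smul_eq_mul]
    linarith

end Polya
end
end

section
/- The conditional expected network exposure F is convex in the curing parameters and concave in the infection parameters: for each fixed y ∈ ℝ_{≥0}^V, the map x ↦ F(x, y) is convex on ℝ_{≥0}^V, and for each fixed x ∈ ℝ_{≥0}^V, the map y ↦ F(x, y) is concave on ℝ_{≥0}^V. -/
open Finset

noncomputable section

namespace Polya

variable {N : ℕ}

/-- Conditional expected network exposure at the next time step, given red/black
super-urn counts `c i`, `d i` for each node, as a function of the curing
parameters `x` and infection parameters `y`. -/
def F (G : SimpleGraph (Fin N)) [DecidableRel G.Adj] (c d : Fin N → ℝ)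
    (x y : Fin N → ℝ) : ℝ :=
  ∑ z : Fin N → Bool,
    (∏ i : Fin N, if z i then c i / (c i + d i) else 1 - c i / (c i + d i)) *
      ((1 / (N : ℝ)) * ∑ i : Fin N,
        (c i + ∑ j ∈ nbhd G i, if z j then y j else 0) /
          (c i + d i + ∑ j ∈ nbhd G i, if z j then y j else x j))

theorem aux_inv (a b u v : ℝ) (ha : 0 ≤ a) (hb : 0 ≤ b) (hab : a + b = 1) (hu : 0 < u)
    (hv : 0 < v) : (a * u + b * v)⁻¹ ≤ a * u⁻¹ + b * v⁻¹ := by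
  have h := (convexOn_zpow (-1) : ConvexOn ℝ (Set.Ioi 0) fun x : ℝ => x ^ (-1 : ℤ)).2
    (Set.mem_Ioi.2 hu) (Set.mem_Ioi.2 hv) ha hb hab
  simpa using h

theorem aux_convex (a b P K s t : ℝ) (ha : 0 ≤ a) (hb : 0 ≤ b) (hab : a + b = 1) (hP : 0 ≤ P)
    (hK : 0 < K) (hs : 0 ≤ s) (ht : 0 ≤ t) :
    P / (K + (a * s + b * t)) ≤ a * (P / (K + s)) + b * (P / (K + t)) := by
  have h := mul_le_mul_of_nonneg_left
    (aux_inv a b (K + s) (K + t) ha hb hab (by linarith) (by linarith)) hP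
  have e : a * (K + s) + b * (K + t) = K + (a * s + b * t) := by
    linear_combination K * hab
  rw [e] at h
  simp only [div_eq_mul_inv]
  linarith

theorem aux_concave (a b c Q s t : ℝ) (ha : 0 ≤ a) (hb : 0 ≤ b) (hab : a + b = 1) (hQ : 0 ≤ Q)
    (hK : 0 < c + Q) (hs : 0 ≤ s) (ht : 0 ≤ t) :
    a * ((c + s) / (c + Q + s)) + b * ((c + t) / (c + Q + t)) ≤
      (c + (a * s + b * t)) / (c + Q + (a * s + b * t)) := by
  have h := aux_convex a b Q (c + Q) s t ha hb hab hQ hK hs ht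
  have key : ∀ w, 0 ≤ w → (c + w) / (c + Q + w) = 1 - Q / (c + Q + w) := by
    intro w hw
    have : c + Q + w ≠ 0 := by linarith
    field_simp
    ring
  rw [key s hs, key t ht, key _ (by positivity)]
  linarith

theorem split_sum (S : Finset (Fin N)) (z : Fin N → Bool) (x y : Fin N → ℝ) :
    (∑ j ∈ S, if z j then y j else x j) =
      (∑ j ∈ S, if z j then y j else 0) + ∑ j ∈ S, if z j then 0 else x j := by
  rw [← Finset.sum_add_distrib]
  refine Finset.sum_congr rfl fun j _ => ?_
  split_ifs <;> simp

theorem lin1 (S : Finset (Fin N)) (z : Fin N → Bool) (a b : ℝ) (x y : Fin N → ℝ) :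
    (∑ j ∈ S, if z j then (a • x + b • y) j else 0) =
      a * (∑ j ∈ S, if z j then x j else 0) + b * ∑ j ∈ S, if z j then y j else 0 := by
  rw [Finset.mul_sum, Finset.mul_sum, ← Finset.sum_add_distrib]
  refine Finset.sum_congr rfl fun j _ => ?_
  split_ifs <;> simp

theorem lin2 (S : Finset (Fin N)) (z : Fin N → Bool) (a b : ℝ) (x y : Fin N → ℝ) :
    (∑ j ∈ S, if z j then 0 else (a • x + b • y) j) =
      a * (∑ j ∈ S, if z j then 0 else x j) + b * ∑ j ∈ S, if z j then 0 else y j := by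
  rw [Finset.mul_sum, Finset.mul_sum, ← Finset.sum_add_distrib]
  refine Finset.sum_congr rfl fun j _ => ?_
  split_ifs <;> simp

theorem nn1 (S : Finset (Fin N)) (z : Fin N → Bool) (x : Fin N → ℝ) (hx : ∀ j, 0 ≤ x j) :
    0 ≤ ∑ j ∈ S, if z j then x j else 0 :=
  Finset.sum_nonneg fun j _ => by split_ifs <;> simp [hx j]

theorem nn2 (S : Finset (Fin N)) (z : Fin N → Bool) (x : Fin N → ℝ) (hx : ∀ j, 0 ≤ x j) :
    0 ≤ ∑ j ∈ S, if z j then 0 else x j :=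
  Finset.sum_nonneg fun j _ => by split_ifs <;> simp [hx j]

theorem orthant_convex : Convex ℝ {x : Fin N → ℝ | ∀ j, 0 ≤ x j} := by
  intro x hx y hy a b ha hb _ j
  have h1 := mul_nonneg ha (hx j)
  have h2 := mul_nonneg hb (hy j)
  simpa using add_nonneg h1 h2

theorem weight_nonneg (c d : Fin N → ℝ) (hc : ∀ i, 0 ≤ c i) (hd : ∀ i, 0 ≤ d i)
    (hcd : ∀ i, 0 < c i + d i) (z : Fin N → Bool) :
    0 ≤ ∏ i : Fin N, if z i then c i / (c i + d i) else 1 - c i / (c i + d i) := by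
  refine Finset.prod_nonneg fun i _ => ?_
  split_ifs
  · exact div_nonneg (hc i) (hcd i).le
  · rw [sub_nonneg, div_le_one (hcd i)]
    linarith [hd i]

/-- the conditional expected network exposure is convex in the
curing parameters and concave in the infection parameters. -/
theorem F_convex_concave (hN : 1 ≤ N)
    (G : SimpleGraph (Fin N)) [DecidableRel G.Adj]
    (c d : Fin N → ℝ) (hc : ∀ i, 0 ≤ c i) (hd : ∀ i, 0 ≤ d i)
    (hcd : ∀ i, 0 < c i + d i) :
    (∀ y : Fin N → ℝ, (∀ j, 0 ≤ y j) →
      ConvexOn ℝ {x : Fin N → ℝ | ∀ j, 0 ≤ x j} (fun x => F G c d x y)) ∧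
    (∀ x : Fin N → ℝ, (∀ j, 0 ≤ x j) →
      ConcaveOn ℝ {y : Fin N → ℝ | ∀ j, 0 ≤ y j} (fun y => F G c d x y)) := by
  constructor
  · intro y hy
    refine ⟨orthant_convex, ?_⟩
    intro x₁ h₁ x₂ h₂ a b ha hb hab
    simp only [F, smul_eq_mul]
    rw [Finset.mul_sum, Finset.mul_sum, ← Finset.sum_add_distrib]
    refine Finset.sum_le_sum fun z _ => ?_
    have hw := weight_nonneg c d hc hd hcd z
    set W := ∏ i : Fin N, if z i then c i / (c i + d i) else 1 - c i / (c i + d i)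
    rw [mul_left_comm a, mul_left_comm b, ← mul_add, mul_left_comm a, mul_left_comm b, ← mul_add]
    refine mul_le_mul_of_nonneg_left (mul_le_mul_of_nonneg_left ?_ (by positivity)) hw
    rw [Finset.mul_sum, Finset.mul_sum, ← Finset.sum_add_distrib]
    refine Finset.sum_le_sum fun i _ => ?_
    have hA := nn1 (nbhd G i) z y hy
    rw [split_sum _ z (a • x₁ + b • x₂), split_sum _ z x₁, split_sum _ z x₂, lin2]
    simp only [← add_assoc (c i + d i)]
    exact aux_convex a b _ _ _ _ ha hb hab (add_nonneg (hc i) hA)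
      (add_pos_of_pos_of_nonneg (hcd i) hA) (nn2 _ z _ h₁) (nn2 _ z _ h₂)
  · intro x hx
    refine ⟨orthant_convex, ?_⟩
    intro y₁ h₁ y₂ h₂ a b ha hb hab
    simp only [F, smul_eq_mul]
    rw [Finset.mul_sum, Finset.mul_sum, ← Finset.sum_add_distrib]
    refine Finset.sum_le_sum fun z _ => ?_
    have hw := weight_nonneg c d hc hd hcd z
    set W := ∏ i : Fin N, if z i then c i / (c i + d i) else 1 - c i / (c i + d i)
    rw [mul_left_comm a, mul_left_comm b, ← mul_add, mul_left_comm a, mul_left_comm b, ← mul_add]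
    refine mul_le_mul_of_nonneg_left (mul_le_mul_of_nonneg_left ?_ (by positivity)) hw
    rw [Finset.mul_sum, Finset.mul_sum, ← Finset.sum_add_distrib]
    refine Finset.sum_le_sum fun i _ => ?_
    have hB := nn2 (nbhd G i) z x hx
    rw [split_sum _ z x (a • y₁ + b • y₂), split_sum _ z x y₁, split_sum _ z x y₂, lin1]
    have e : ∀ A B : ℝ, c i + d i + (A + B) = c i + (d i + B) + A := fun A B => by ring
    simp only [e]
    exact aux_concave a b _ _ _ _ ha hb hab (add_nonneg (hd i) hB)
      (by linarith [hcd i]) (nn1 _ z _ h₁) (nn1 _ z _ h₂)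

end Polya
end
end

section
/- The conditional expected network exposure F is monotone in its arguments: if x, x' ∈ ℝ_{≥0}^V satisfy x_j ≤ x'_j for all j ∈ V, then F(x', y) ≤ F(x, y) for every y ∈ ℝ_{≥0}^V; and if y, y' ∈ ℝ_{≥0}^V satisfy y_j ≤ y'_j for all j ∈ V, then F(x, y) ≤ F(x, y') for every x ∈ ℝ_{≥0}^V. -/
open Finset

noncomputable section

namespace Polya

variable {N : ℕ}

theorem F_mono_aux
    (G : SimpleGraph (Fin N)) [DecidableRel G.Adj]
    (c d : Fin N → ℝ) (hc : ∀ i, 0 ≤ c i) (hd : ∀ i, 0 ≤ d i)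
    (hcd : ∀ i, 0 < c i + d i) (x x' y y' : Fin N → ℝ)
    (hx : ∀ j, 0 ≤ x j) (hy : ∀ j, 0 ≤ y j)
    (hxx : ∀ j, x j ≤ x' j) (hyy : ∀ j, y j ≤ y' j) :
    F G c d x' y ≤ F G c d x y' := by
  have hsplit : ∀ (z : Fin N → Bool) (s : Finset (Fin N)) (u v : Fin N → ℝ),
      (∑ j ∈ s, if z j then v j else u j) =
      (∑ j ∈ s, if z j then v j else 0) + ∑ j ∈ s, if z j then 0 else u j := by
    intro z s u v
    rw [← Finset.sum_add_distrib]
    refine Finset.sum_congr rfl fun j _ => ?_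
    split_ifs <;> simp
  unfold F
  refine Finset.sum_le_sum fun z _ => mul_le_mul_of_nonneg_left
    (mul_le_mul_of_nonneg_left (Finset.sum_le_sum fun i _ => ?_) (by positivity)) ?_
  · rw [hsplit z _ x' y, hsplit z _ x y']
    have h1 : (∑ j ∈ nbhd G i, if z j then y j else 0) ≤
        ∑ j ∈ nbhd G i, if z j then y' j else 0 :=
      Finset.sum_le_sum fun j _ => by split_ifs <;> simp [hyy j]
    have h2 : (∑ j ∈ nbhd G i, if z j then 0 else x j) ≤
        ∑ j ∈ nbhd G i, if z j then 0 else x' j :=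
      Finset.sum_le_sum fun j _ => by split_ifs <;> simp [hxx j]
    have h3 : 0 ≤ (∑ j ∈ nbhd G i, if z j then y j else 0) :=
      Finset.sum_nonneg fun j _ => by split_ifs <;> simp [hy j]
    have h4 : 0 ≤ (∑ j ∈ nbhd G i, if z j then 0 else x j) :=
      Finset.sum_nonneg fun j _ => by split_ifs <;> simp [hx j]
    generalize (∑ j ∈ nbhd G i, if z j then y j else 0) = A at *
    generalize (∑ j ∈ nbhd G i, if z j then y' j else 0) = A' at *
    generalize (∑ j ∈ nbhd G i, if z j then 0 else x j) = B at *
    generalize (∑ j ∈ nbhd G i, if z j then 0 else x' j) = B' at *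
    have := hc i
    have := hd i
    have := hcd i
    rw [div_le_div_iff₀ (by linarith) (by linarith)]
    have key : (c i + A) * (d i + B) ≤ (c i + A') * (d i + B') :=
      mul_le_mul (by linarith) (by linarith) (by linarith) (by linarith)
    linarith
  · refine Finset.prod_nonneg fun i _ => ?_
    have := hc i
    have := hd i
    have := hcd i
    split_ifs
    · positivity
    · rw [sub_nonneg, div_le_one (hcd i)]
      linarith

/-- the conditional expected network exposure is nonincreasing in
the curing parameters and nondecreasing in the infection parameters. -/
theorem F_monotone (hN : 1 ≤ N)
    (G : SimpleGraph (Fin N)) [DecidableRel G.Adj]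
    (c d : Fin N → ℝ) (hc : ∀ i, 0 ≤ c i) (hd : ∀ i, 0 ≤ d i)
    (hcd : ∀ i, 0 < c i + d i) :
    (∀ x x' y : Fin N → ℝ, (∀ j, 0 ≤ x j) → (∀ j, 0 ≤ x' j) → (∀ j, 0 ≤ y j) →
      (∀ j, x j ≤ x' j) → F G c d x' y ≤ F G c d x y) ∧
    (∀ x y y' : Fin N → ℝ, (∀ j, 0 ≤ x j) → (∀ j, 0 ≤ y j) → (∀ j, 0 ≤ y' j) →
      (∀ j, y j ≤ y' j) → F G c d x y ≤ F G c d x y') := by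
  exact ⟨fun x x' y hx _ hy h => F_mono_aux G c d hc hd hcd x x' y y hx hy h fun _ => le_rfl,
    fun x y y' hx hy _ h => F_mono_aux G c d hc hd hcd x x y y' hx hy (fun _ => le_rfl) h⟩

end Polya
end
end

section
/- Assume in addition that c_i > 0 and d_i > 0 for all i ∈ V (so 0 < s_i < 1), and let 𝓑_b > 0, 𝓑_r > 0 with X = {x ∈ ℝ^V : x_j ≥ 0, Σ_j x_j ≤ 𝓑_b} and Y = {y ∈ ℝ^V : y_j ≥ 0, Σ_j y_j ≤ 𝓑_r}. Then every Nash equilibrium (x*, y*) of the game on F (i.e., every pair with F(x*, y) ≤ F(x*, y*) ≤ F(x, y*) for all x ∈ X, y ∈ Y) uses the full budgets: Σ_{j∈V} x*_j = 𝓑_b and Σ_{j∈V} y*_j = 𝓑_r. -/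
open Finset

noncomputable section

namespace Polya

variable {N : ℕ}

theorem ratio_le {A A' B B' : ℝ} (hA : 0 < A) (hB' : 0 < B') (h1 : A ≤ A') (h2 : B' ≤ B) :
    A / (A + B) ≤ A' / (A' + B') := by
  rw [div_le_div_iff₀ (by linarith) (by linarith)]
  nlinarith [mul_le_mul h1 h2 hB'.le (by linarith)]

theorem ratio_lt {A A' B B' : ℝ} (hA : 0 < A) (hB' : 0 < B') (h1 : A ≤ A') (h2 : B' ≤ B)
    (h : A < A' ∨ B' < B) :
    A / (A + B) < A' / (A' + B') := by
  rw [div_lt_div_iff₀ (by linarith) (by linarith)]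
  rcases h with h | h
  · nlinarith [mul_lt_mul h h2 hB' (by linarith)]
  · nlinarith [mul_le_mul_of_nonneg_right h1 (by linarith : 0 ≤ B), mul_lt_mul_of_pos_left h hA]

theorem term_eq (G : SimpleGraph (Fin N)) [DecidableRel G.Adj] (c d x y : Fin N → ℝ)
    (z : Fin N → Bool) (i : Fin N) :
    (c i + d i + ∑ j ∈ nbhd G i, if z j then y j else x j) =
    (c i + ∑ j ∈ nbhd G i, if z j then y j else 0) +
      (d i + ∑ j ∈ nbhd G i, if z j then 0 else x j) := by
  have : (∑ j ∈ nbhd G i, if z j then y j else x j) =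
      (∑ j ∈ nbhd G i, if z j then y j else 0) + ∑ j ∈ nbhd G i, if z j then 0 else x j := by
    rw [← Finset.sum_add_distrib]
    refine Finset.sum_congr rfl fun j _ => ?_
    split_ifs <;> simp
  rw [this]; ring

theorem F_lt (hN : 1 ≤ N) (G : SimpleGraph (Fin N)) [DecidableRel G.Adj]
    (c d : Fin N → ℝ) (hc : ∀ i, 0 < c i) (hd : ∀ i, 0 < d i)
    (x x' y y' : Fin N → ℝ) (hx' : ∀ j, 0 ≤ x' j) (hy : ∀ j, 0 ≤ y j)
    (hxx : ∀ j, x' j ≤ x j) (hyy : ∀ j, y j ≤ y' j)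
    (h : (∀ j, x' j < x j) ∨ (∀ j, y j < y' j)) :
    F G c d x y < F G c d x' y' := by
  have hNpos : (0 : ℝ) < 1 / (N : ℝ) := by
    have : (0 : ℝ) < N := by exact_mod_cast hN
    positivity
  have hw : ∀ z : Fin N → Bool,
      0 < ∏ i : Fin N, if z i then c i / (c i + d i) else 1 - c i / (c i + d i) := by
    intro z
    refine Finset.prod_pos fun i _ => ?_
    have := hc i
    have := hd i
    split_ifs
    · positivity
    · rw [sub_pos, div_lt_one (by linarith)]; linarith
  have hne : ∀ i, (nbhd G i).Nonempty := fun i => ⟨i, by simp [nbhd]⟩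
  have hA : ∀ (z : Fin N → Bool) i, 0 < c i + ∑ j ∈ nbhd G i, if z j then y j else 0 := by
    intro z i
    refine add_pos_of_pos_of_nonneg (hc i) (Finset.sum_nonneg fun j _ => ?_)
    split_ifs
    · exact hy j
    · exact le_rfl
  have hB : ∀ (z : Fin N → Bool) i, 0 < d i + ∑ j ∈ nbhd G i, if z j then 0 else x' j := by
    intro z i
    refine add_pos_of_pos_of_nonneg (hd i) (Finset.sum_nonneg fun j _ => ?_)
    split_ifs
    · exact le_rfl
    · exact hx' j
  have hAA : ∀ (z : Fin N → Bool) i, (c i + ∑ j ∈ nbhd G i, if z j then y j else 0) ≤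
      c i + ∑ j ∈ nbhd G i, if z j then y' j else 0 := by
    intro z i
    refine add_le_add le_rfl (Finset.sum_le_sum fun j _ => ?_)
    split_ifs
    · exact hyy j
    · exact le_rfl
  have hBB : ∀ (z : Fin N → Bool) i, (d i + ∑ j ∈ nbhd G i, if z j then 0 else x' j) ≤
      d i + ∑ j ∈ nbhd G i, if z j then 0 else x j := by
    intro z i
    refine add_le_add le_rfl (Finset.sum_le_sum fun j _ => ?_)
    split_ifs
    · exact le_rfl
    · exact hxx j
  unfold F
  simp only [term_eq]
  have huniv : (Finset.univ : Finset (Fin N)).Nonempty := ⟨⟨0, hN⟩, Finset.mem_univ _⟩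
  refine Finset.sum_lt_sum (fun z _ => ?_) ?_
  · exact mul_le_mul_of_nonneg_left (mul_le_mul_of_nonneg_left
      (Finset.sum_le_sum fun i _ => ratio_le (hA z i) (hB z i) (hAA z i) (hBB z i)) hNpos.le)
      (hw z).le
  · rcases h with h | h
    · refine ⟨fun _ => false, Finset.mem_univ _, ?_⟩
      refine mul_lt_mul_of_pos_left (mul_lt_mul_of_pos_left
        (Finset.sum_lt_sum_of_nonempty huniv fun i _ =>
          ratio_lt (hA _ i) (hB _ i) (hAA _ i) (hBB _ i) (Or.inr ?_)) hNpos) (hw _)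
      simpa using Finset.sum_lt_sum_of_nonempty (hne i) fun j _ => h j
    · refine ⟨fun _ => true, Finset.mem_univ _, ?_⟩
      refine mul_lt_mul_of_pos_left (mul_lt_mul_of_pos_left
        (Finset.sum_lt_sum_of_nonempty huniv fun i _ =>
          ratio_lt (hA _ i) (hB _ i) (hAA _ i) (hBB _ i) (Or.inl ?_)) hNpos) (hw _)
      simpa using Finset.sum_lt_sum_of_nonempty (hne i) fun j _ => h j

theorem slack (hN : 1 ≤ N) (x : Fin N → ℝ) (B : ℝ) (hx : ∀ j, 0 ≤ x j) (h : ∑ j, x j < B) :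
    ∃ x' : Fin N → ℝ, (∀ j, x j < x' j) ∧ ((∀ j, 0 ≤ x' j) ∧ ∑ j, x' j ≤ B) := by
  have hNpos : (0 : ℝ) < N := by exact_mod_cast hN
  have he : 0 < (B - ∑ j, x j) / N := div_pos (by linarith) hNpos
  refine ⟨fun j => x j + (B - ∑ j, x j) / N, fun j => by linarith, fun j => ?_, ?_⟩
  · have := hx j
    linarith
  · rw [Finset.sum_add_distrib]
    simp only [Finset.sum_const, Finset.card_univ, Fintype.card_fin, nsmul_eq_mul]
    rw [mul_div_cancel₀ _ hNpos.ne']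
    linarith

/-- when all `c i` and `d i` are strictly positive and the budgets
are positive, every Nash equilibrium of the game on the conditional expected
network exposure uses the full budgets. -/
theorem F_nash_full_budget (hN : 1 ≤ N)
    (G : SimpleGraph (Fin N)) [DecidableRel G.Adj]
    (c d : Fin N → ℝ) (hc : ∀ i, 0 < c i) (hd : ∀ i, 0 < d i)
    (Bb Br : ℝ) (hBb : 0 < Bb) (hBr : 0 < Br)
    (xstar ystar : Fin N → ℝ)
    (hx : xstar ∈ {x : Fin N → ℝ | (∀ j, 0 ≤ x j) ∧ ∑ j, x j ≤ Bb})
    (hy : ystar ∈ {y : Fin N → ℝ | (∀ j, 0 ≤ y j) ∧ ∑ j, y j ≤ Br})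
    (hNashY : ∀ y ∈ {y : Fin N → ℝ | (∀ j, 0 ≤ y j) ∧ ∑ j, y j ≤ Br},
      F G c d xstar y ≤ F G c d xstar ystar)
    (hNashX : ∀ x ∈ {x : Fin N → ℝ | (∀ j, 0 ≤ x j) ∧ ∑ j, x j ≤ Bb},
      F G c d xstar ystar ≤ F G c d x ystar) :
    ∑ j, xstar j = Bb ∧ ∑ j, ystar j = Br := by
  refine ⟨?_, ?_⟩
  · by_contra hne
    obtain ⟨x', h1, h2⟩ := slack hN xstar Bb hx.1 (lt_of_le_of_ne hx.2 hne)
    exact absurd (hNashX x' h2) (not_le.mpr (F_lt hN G c d hc hd x' xstar ystar ystar hx.1 hy.1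
      (fun j => (h1 j).le) (fun _ => le_rfl) (Or.inl h1)))
  · by_contra hne
    obtain ⟨y', h1, h2⟩ := slack hN ystar Br hy.1 (lt_of_le_of_ne hy.2 hne)
    exact absurd (hNashY y' h2) (not_le.mpr (F_lt hN G c d hc hd xstar xstar ystar y' hx.1 hy.1
      (fun _ => le_rfl) (fun j => (h1 j).le) (Or.inr h1)))

end Polya
end
end
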